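/- Let m ≥ 2 be an integer, q complex with 0 < |q| < 1, and x_1,…,x_{m−1} complex numbers with x_{m−1} ≠ 0. Let K_m^{(0)}(y_1,…,y_{m−1}) = Σ_{c_1,…,c_{m−1}=0}^{∞} (−1)^{c_{m−1}} q^{c_{m−1}(c_{m−1}+1)/2} y_{m−1}^{c_{m−1}} Π_{i=1}^{m−2} q^{c_i²+c_i} y_i^{c_i} [c_{i+1} choose c_i]_q. Then Σ_{j=0}^{m−2} q^{j} · (x_{m−1−j}·x_{m−j}⋯x_{m−2}) · K_m^{(0)}( q^{−1}x_1, …, q^{−1}x_{m−2−j}, x_{m−1−j}, q·x_{m−j}, …, q·x_{m−1} ) = (1/x_{m−1}) · ( 1 − K_m^{(0)}(q^{−1}x_1, …, q^{−1}x_{m−1}) ), where the j = 0 summand is K_m^{(0)}(q^{−1}x_1,…,q^{−1}x_{m−2}, x_{m−1}) with empty coefficient product equal to 1 and the j-th coefficient is q^j times the product x_{m−1−j} x_{m−j} ⋯ x_{m−2}. -/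

import Mathlib

open scoped BigOperators

/-- The Gaussian binomial coefficient `[M choose n]_q`: equal to
`(q)_M/((q)_n (q)_{M−n})` for `M ≥ n ≥ 0` and to `0` otherwise; defined via the
`q`-Pascal recursion (hence an integer polynomial in `q`). -/
def qBinom (q : ℂ) : ℕ → ℕ → ℂ
  | _, 0 => 1
  | 0, _ + 1 => 0
  | M + 1, n + 1 => q ^ (n + 1) * qBinom q M (n + 1) + qBinom q M n

/-- General term of the multivariate series `K_m^{(a)}(x_1,…,x_{m−1})` with `m = p+2`,
summed over `c : Fin (p+1) → ℕ` (`c j` is `c_{j+1}`): the last slot contributes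
`(−1)^{c_{m−1}} q^{c_{m−1}(c_{m−1}+1)/2} x_{m−1}^{c_{m−1}}`, slot `i` for `1 ≤ i ≤ a−1`
(resp. `i = a`, resp. `a+1 ≤ i ≤ m−2`) contributes `q^{c_i²} x_i^{c_i} [c_{i+1} choose c_i]_q`
(resp. `q^{c_a²} x_a^{c_a} [c_{a+1}+1 choose c_a]_q`, resp.
`q^{c_i²+c_i} x_i^{c_i} [c_{i+1} choose c_i]_q`); for `a = 0` all slots
`1 ≤ i ≤ m−2` carry `q^{c_i²+c_i} x_i^{c_i} [c_{i+1} choose c_i]_q`. -/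
noncomputable def KtermM (p a : ℕ) (q : ℂ) (x : Fin (p + 1) → ℂ)
    (c : Fin (p + 1) → ℕ) : ℂ :=
  (-1 : ℂ) ^ (c (Fin.last p)) *
    q ^ ((c (Fin.last p) * (c (Fin.last p) + 1)) / 2) *
    (x (Fin.last p)) ^ (c (Fin.last p)) *
    ∏ j : Fin p,
      q ^ ((c j.castSucc) ^ 2 + (if a ≤ (j : ℕ) then c j.castSucc else 0)) *
        (x j.castSucc) ^ (c j.castSucc) *
        qBinom q (c j.succ + (if (j : ℕ) + 1 = a then 1 else 0)) (c j.castSucc)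

open Finset

theorem qBinom_zero_right (q : ℂ) (n : ℕ) : qBinom q n 0 = 1 := by
  cases n <;> simp [qBinom]

theorem qBinom_succ_succ (q : ℂ) (n c : ℕ) :
    qBinom q (n + 1) (c + 1) = q ^ (c + 1) * qBinom q n (c + 1) + qBinom q n c := by
  simp [qBinom]

theorem qBinom_eq_zero_of_lt (q : ℂ) {n c : ℕ} (h : n < c) : qBinom q n c = 0 := by
  induction n generalizing c with
  | zero => cases c with
    | zero => omega
    | succ c => simp [qBinom]
  | succ n ih => cases c with
    | zero => omega
    | succ c => rw [qBinom_succ_succ, ih (by omega), ih (by omega)]; simp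

/-- The second `q`-Pascal rule, multiplied by `q ^ c` to avoid subtraction in the exponent. -/
theorem pow_mul_qBinom_succ_succ (q : ℂ) (n c : ℕ) :
    q ^ c * qBinom q (n + 1) (c + 1) =
      q ^ c * qBinom q n (c + 1) + q ^ n * qBinom q n c := by
  induction n generalizing c with
  | zero => cases c <;> simp [qBinom]
  | succ n ih =>
    have h := ih c
    cases c with
    | zero =>
      rw [qBinom_succ_succ q (n + 1), qBinom_succ_succ q n 0] at *
      simp only [qBinom_zero_right] at *
      linear_combination q * h
    | succ c =>
      have h' := ih c
      rw [qBinom_succ_succ q (n + 1) (c + 1)]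
      rw [qBinom_succ_succ q n (c + 1)] at h ⊢
      rw [qBinom_succ_succ q n c] at h' ⊢
      linear_combination q ^ (c + 2) * h + q * h'

theorem norm_qBinom_le {q : ℂ} (hq : ‖q‖ ≤ 1) (n c : ℕ) : ‖qBinom q n c‖ ≤ 2 ^ n := by
  induction n generalizing c with
  | zero => cases c <;> simp [qBinom]
  | succ n ih => cases c with
    | zero => simpa [qBinom_zero_right] using one_le_pow₀ (by norm_num : (1 : ℝ) ≤ 2)
    | succ c =>
      rw [qBinom_succ_succ]
      have h1 : ‖q ^ (c + 1) * qBinom q n (c + 1)‖ ≤ 1 * 2 ^ n := by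
        rw [norm_mul, norm_pow]
        exact mul_le_mul (pow_le_one₀ (norm_nonneg _) hq) (ih _) (norm_nonneg _) zero_le_one
      calc _ ≤ _ := norm_add_le _ _
        _ ≤ 1 * 2 ^ n + 2 ^ n := add_le_add h1 (ih c)
        _ = 2 ^ (n + 1) := by ring

/-- The weight of slot `c` followed by slot `n`, with variable `y`, in `K_m^{(0)}`. -/
noncomputable def slotWeight (q y : ℂ) (n c : ℕ) : ℂ :=
  q ^ (c ^ 2 + c) * y ^ c * qBinom q n c

/-- The sum over the first `p` slots of `K_m^{(0)}` when the last slot equals `n`. -/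
noncomputable def innerSum (q : ℂ) (y : ℕ → ℂ) : ℕ → ℕ → ℂ
  | 0, _ => 1
  | p + 1, n => ∑ c ∈ range (n + 1), slotWeight q (y p) n c * innerSum q y p c

theorem innerSum_succ (q : ℂ) (y : ℕ → ℂ) (p n : ℕ) :
    innerSum q y (p + 1) n =
      ∑ c ∈ range (n + 1), slotWeight q (y p) n c * innerSum q y p c := rfl

theorem innerSum_congr (q : ℂ) {y z : ℕ → ℂ} {p : ℕ} (h : ∀ k < p, y k = z k) (n : ℕ) :
    innerSum q y p n = innerSum q z p n := by
  induction p generalizing n with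
  | zero => rfl
  | succ p ih =>
    rw [innerSum_succ, innerSum_succ, h p (by omega)]
    exact sum_congr rfl fun c _ => by rw [ih fun k hk => h k (by omega)]

@[simp]
theorem innerSum_zero_right (q : ℂ) (y : ℕ → ℂ) (p : ℕ) : innerSum q y p 0 = 1 := by
  induction p with
  | zero => rfl
  | succ p ih => simp [innerSum_succ, slotWeight, qBinom_zero_right, ih]

/-- The arguments `q⁻¹x_1, …, q⁻¹x_{p-j}, x_{p+1-j}, q x_{p+2-j}, …` (with `x_{k+1} = x k`). -/
noncomputable def shiftedArg (q : ℂ) (x : ℕ → ℂ) (p j k : ℕ) : ℂ :=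
  if k + 1 ≤ p - j then q⁻¹ * x k else if k + 1 = p + 1 - j then x k else q * x k

theorem shiftedArg_of_lt (q : ℂ) (x : ℕ → ℂ) {p j k : ℕ} (h : k < p - j) :
    shiftedArg q x p j k = q⁻¹ * x k := by
  simp [shiftedArg, Nat.succ_le_of_lt h]

theorem shiftedArg_sub (q : ℂ) (x : ℕ → ℂ) {p j : ℕ} (h : j ≤ p) :
    shiftedArg q x p j (p - j) = x (p - j) := by
  rw [shiftedArg, if_neg (by omega), if_pos (by omega)]

theorem shiftedArg_of_gt (q : ℂ) (x : ℕ → ℂ) {p j k : ℕ} (h : p < k + j) (hj : j ≤ p) :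
    shiftedArg q x p j k = q * x k := by
  rw [shiftedArg, if_neg (by omega), if_neg (by omega)]

theorem shiftedArg_succ_succ (q : ℂ) (x : ℕ → ℂ) (p j k : ℕ) :
    shiftedArg q x (p + 1) (j + 1) k = shiftedArg q x p j k := by
  simp [shiftedArg]

theorem slotWeight_mul_left (q y : ℂ) (n c : ℕ) :
    slotWeight q (q * y) n c = q ^ c * slotWeight q y n c := by
  simp only [slotWeight, mul_pow]; ring

theorem slotWeight_succ_succ {q : ℂ} (hq : q ≠ 0) (y : ℂ) (n c : ℕ) :
    slotWeight q (q⁻¹ * y) (n + 1) (c + 1) =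
      slotWeight q (q⁻¹ * y) n (c + 1) + q ^ (n + 1) * y * slotWeight q y n c := by
  have h : q ^ ((c + 1) ^ 2 + (c + 1)) * (q⁻¹ * y) ^ (c + 1) =
      q ^ (c ^ 2 + c + 1) * q ^ c * y ^ (c + 1) := by
    rw [mul_pow, inv_pow]; field_simp; ring
  simp only [slotWeight, h]
  linear_combination q ^ (c ^ 2 + c + 1) * y ^ (c + 1) * pow_mul_qBinom_succ_succ q n c

theorem innerSum_succ_right {q : ℂ} (hq : q ≠ 0) (x : ℕ → ℂ) (p n : ℕ) :
    innerSum q (fun k => q⁻¹ * x k) p (n + 1) =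
      innerSum q (fun k => q⁻¹ * x k) p n +
        ∑ j ∈ range p, q ^ (j + 1 + n) * (∏ k ∈ Ico (p - (j + 1)) p, x k) *
          innerSum q (shiftedArg q x p (j + 1)) p n := by
  induction p generalizing n with
  | zero => simp [innerSum]
  | succ p ih =>
    set y : ℕ → ℂ := fun k => q⁻¹ * x k with hy
    have hext : innerSum q y (p + 1) n =
        ∑ c ∈ range (n + 2), slotWeight q (y p) n c * innerSum q y p c := by
      rw [innerSum_succ, sum_range_succ _ (n + 1), slotWeight,
        qBinom_eq_zero_of_lt q (Nat.lt_succ_self n)]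
      simp
    have hdiff : innerSum q y (p + 1) (n + 1) = innerSum q y (p + 1) n +
        ∑ c ∈ range (n + 1), q ^ (n + 1) * x p * slotWeight q (x p) n c *
          innerSum q y p (c + 1) := by
      rw [hext, innerSum_succ, sum_range_succ', sum_range_succ' _ (n + 1)]
      simp only [hy, slotWeight_succ_succ hq, add_mul, sum_add_distrib]
      simp only [slotWeight, qBinom_zero_right]
      ring
    have hfirst : innerSum q (shiftedArg q x (p + 1) 1) (p + 1) n =
        ∑ c ∈ range (n + 1), slotWeight q (x p) n c * innerSum q y p c := by
      have hp : shiftedArg q x (p + 1) 1 p = x p := shiftedArg_sub q x (p := p + 1) (by omega)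
      rw [innerSum_succ, hp]
      exact sum_congr rfl fun c _ => by
        rw [innerSum_congr q fun k hk => shiftedArg_of_lt q x (by omega)]
    have hrest : ∀ j ∈ range p, innerSum q (shiftedArg q x (p + 1) (j + 1 + 1)) (p + 1) n =
        ∑ c ∈ range (n + 1), q ^ c * slotWeight q (x p) n c *
          innerSum q (shiftedArg q x p (j + 1)) p c := by
      intro j hj
      rw [mem_range] at hj
      rw [innerSum_succ, shiftedArg_of_gt q x (by omega) (by omega)]
      exact sum_congr rfl fun c _ => by
        rw [slotWeight_mul_left, innerSum_congr q fun k _ => shiftedArg_succ_succ q x p (j + 1) k]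
    have hprod : ∀ j, ∏ k ∈ Ico (p + 1 - (j + 1 + 1)) (p + 1), x k =
        (∏ k ∈ Ico (p - (j + 1)) p, x k) * x p := by
      intro j
      rw [prod_Ico_succ_top (by omega), Nat.add_sub_add_right]
    rw [hdiff, sum_range_succ' _ p, hfirst]
    have hsum : ∑ j ∈ range p, q ^ (j + 1 + 1 + n) *
          (∏ k ∈ Ico (p + 1 - (j + 1 + 1)) (p + 1), x k) *
          innerSum q (shiftedArg q x (p + 1) (j + 1 + 1)) (p + 1) n =
        ∑ c ∈ range (n + 1), ∑ j ∈ range p, q ^ (n + 1) * x p * slotWeight q (x p) n c *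
          (q ^ (j + 1 + c) * (∏ k ∈ Ico (p - (j + 1)) p, x k) *
            innerSum q (shiftedArg q x p (j + 1)) p c) := by
      rw [sum_comm]
      refine sum_congr rfl fun j hj => ?_
      rw [hrest j hj, hprod, mul_sum]
      exact sum_congr rfl fun c _ => by ring
    rw [hsum]
    simp only [ih, mul_add, sum_add_distrib, ← mul_sum]
    simp [mul_assoc, mul_sum]
    ring_nf

theorem triangle_succ (n : ℕ) : (n + 1) * (n + 1 + 1) / 2 = n * (n + 1) / 2 + (n + 1) := by
  rw [show (n + 1) * (n + 1 + 1) = n * (n + 1) + (n + 1) * 2 by ring,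
    Nat.add_mul_div_right _ _ two_pos]

theorem summable_pow_triangle_mul_pow {r : ℝ} (hr0 : 0 ≤ r) (hr1 : r < 1) {R : ℝ} (hR : 0 ≤ R) :
    Summable fun n : ℕ => r ^ (n * (n + 1) / 2) * R ^ n := by
  have ht : Filter.Tendsto (fun n : ℕ => r ^ (n + 1) * R) Filter.atTop (nhds (0 * R)) :=
    ((Filter.tendsto_add_atTop_iff_nat 1).2
      (tendsto_pow_atTop_nhds_zero_of_lt_one hr0 hr1)).mul_const R
  rw [zero_mul] at ht
  refine summable_of_ratio_norm_eventually_le (r := 1 / 2) (by norm_num) ?_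
  filter_upwards [ht.eventually_le_const (by norm_num : (0 : ℝ) < 1 / 2)] with n hn
  rw [Real.norm_of_nonneg (by positivity), Real.norm_of_nonneg (by positivity),
    triangle_succ]
  calc _ = (r ^ (n + 1) * R) * (r ^ (n * (n + 1) / 2) * R ^ n) := by ring
    _ ≤ _ := by gcongr

theorem summable_fin_prod {n : ℕ} {f : Fin n → ℕ → ℝ} (hf : ∀ i k, 0 ≤ f i k)
    (hs : ∀ i, Summable (f i)) : Summable fun c : Fin n → ℕ => ∏ i, f i (c i) := by
  induction n with
  | zero => exact Summable.of_finite
  | succ n ih =>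
    rw [← (Fin.consEquiv fun _ => ℕ).summable_iff]
    have := (hs 0).mul_of_nonneg (ih (f := fun i => f i.succ) (fun i => hf _) fun i => hs _)
      (hf 0) fun c => prod_nonneg fun i _ => hf _ _
    refine this.congr fun c => ?_
    simp [Fin.prod_univ_succ, Fin.consEquiv]

theorem snocEquiv_mk (p n : ℕ) (c : Fin p → ℕ) :
    (Fin.snocEquiv fun _ => ℕ) (n, c) = Fin.snoc (α := fun _ => ℕ) c n := rfl

/-- The product of the slot weights in a term of `K_m^{(0)}`. -/
noncomputable def chainTerm (q : ℂ) (y : ℕ → ℂ) (p : ℕ) (c : Fin (p + 1) → ℕ) : ℂ :=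
  ∏ j : Fin p, slotWeight q (y j) (c j.succ) (c j.castSucc)

theorem chainTerm_snoc (q : ℂ) (y : ℕ → ℂ) (p n : ℕ) (c : Fin (p + 1) → ℕ) :
    chainTerm q y (p + 1) (Fin.snoc (α := fun _ => ℕ) c n) =
      slotWeight q (y p) n (c (Fin.last p)) * chainTerm q y p c := by
  rw [chainTerm, Fin.prod_univ_castSucc, mul_comm]
  simp only [Fin.succ_last, Fin.snoc_last, Fin.snoc_castSucc, Fin.val_last, Fin.val_castSucc,
    Fin.succ_castSucc, chainTerm]

theorem KtermM_eq (p : ℕ) (q : ℂ) (y : ℕ → ℂ) (c : Fin (p + 1) → ℕ) :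
    KtermM p 0 q (fun k => y k) c =
      (-1) ^ c (Fin.last p) * q ^ (c (Fin.last p) * (c (Fin.last p) + 1) / 2) *
        y p ^ c (Fin.last p) * chainTerm q y p c := by
  simp [KtermM, chainTerm, slotWeight]

theorem norm_slotWeight_le {q : ℂ} (hq : ‖q‖ ≤ 1) (y : ℂ) (n c : ℕ) :
    ‖slotWeight q y n c‖ ≤ ‖q‖ ^ (c * (c + 1) / 2) * ‖y‖ ^ c * 2 ^ n := by
  rw [slotWeight, norm_mul, norm_mul, norm_pow, norm_pow]
  refine mul_le_mul (mul_le_mul_of_nonneg_right ?_ (by positivity)) (norm_qBinom_le hq n c)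
    (norm_nonneg _) (by positivity)
  refine pow_le_pow_of_le_one (norm_nonneg _) hq ((Nat.div_le_self _ _).trans_eq (by ring))

theorem norm_chainTerm_le {q : ℂ} (hq : ‖q‖ ≤ 1) (y : ℕ → ℂ) (p : ℕ) (c : Fin (p + 1) → ℕ) :
    ‖chainTerm q y p c‖ ≤
      (∏ j : Fin p, ‖q‖ ^ (c j.castSucc * (c j.castSucc + 1) / 2) *
        (2 * ‖y j‖) ^ c j.castSucc) * 2 ^ c (Fin.last p) := by
  have hshift : (∏ j : Fin p, (2 : ℝ) ^ c j.succ) ≤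
      (∏ j : Fin p, (2 : ℝ) ^ c j.castSucc) * 2 ^ c (Fin.last p) := by
    rw [← Fin.prod_univ_castSucc (fun j => (2 : ℝ) ^ c j), Fin.prod_univ_succ]
    exact le_mul_of_one_le_left (by positivity) (one_le_pow₀ one_le_two)
  calc ‖chainTerm q y p c‖
      ≤ ∏ j : Fin p, (‖q‖ ^ (c j.castSucc * (c j.castSucc + 1) / 2) * ‖y j‖ ^ c j.castSucc *
          2 ^ c j.succ) := by
        rw [chainTerm, norm_prod]
        exact prod_le_prod (fun _ _ => norm_nonneg _) fun j _ => norm_slotWeight_le hq _ _ _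
    _ ≤ (∏ j : Fin p, ‖q‖ ^ (c j.castSucc * (c j.castSucc + 1) / 2) * ‖y j‖ ^ c j.castSucc) *
          ((∏ j : Fin p, (2 : ℝ) ^ c j.castSucc) * 2 ^ c (Fin.last p)) := by
        rw [prod_mul_distrib]
        exact mul_le_mul_of_nonneg_left hshift (prod_nonneg fun _ _ => by positivity)
    _ = _ := by
        rw [← mul_assoc, ← prod_mul_distrib]
        exact congrArg (· * _) (prod_congr rfl fun j _ => by ring)

theorem summable_chainTerm_snoc {q : ℂ} (hq : ‖q‖ < 1) (y : ℕ → ℂ) (p n : ℕ) :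
    Summable fun c : Fin p → ℕ => chainTerm q y p (Fin.snoc (α := fun _ => ℕ) c n) := by
  have hs := summable_fin_prod
    (f := fun (i : Fin p) k => ‖q‖ ^ (k * (k + 1) / 2) * (2 * ‖y i‖) ^ k)
    (fun _ _ => by positivity)
    fun i => summable_pow_triangle_mul_pow (norm_nonneg q) hq (by positivity)
  refine Summable.of_norm_bounded (hs.mul_right (2 ^ n)) fun c => ?_
  simpa using norm_chainTerm_le hq.le y p (Fin.snoc (α := fun _ => ℕ) c n)

theorem summable_KtermM {q : ℂ} (hq : ‖q‖ < 1) (y : ℕ → ℂ) (p : ℕ) :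
    Summable fun c : Fin (p + 1) → ℕ => KtermM p 0 q (fun k => y k) c := by
  have hs := summable_fin_prod
    (f := fun (i : Fin (p + 1)) k => ‖q‖ ^ (k * (k + 1) / 2) * (2 * ‖y i‖) ^ k)
    (fun _ _ => by positivity)
    fun i => summable_pow_triangle_mul_pow (norm_nonneg q) hq (by positivity)
  refine Summable.of_norm_bounded hs fun c => ?_
  rw [KtermM_eq, norm_mul, Fin.prod_univ_castSucc]
  refine (mul_le_mul_of_nonneg_left (norm_chainTerm_le hq.le y p c) (norm_nonneg _)).trans_eq ?_
  simp [mul_pow]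
  ring

theorem tsum_chainTerm_snoc {q : ℂ} (hq : ‖q‖ < 1) (y : ℕ → ℂ) (p n : ℕ) :
    ∑' c : Fin p → ℕ, chainTerm q y p (Fin.snoc (α := fun _ => ℕ) c n) = innerSum q y p n := by
  induction p generalizing n with
  | zero => simp [chainTerm, innerSum]
  | succ p ih =>
    have hs := summable_chainTerm_snoc hq y (p + 1) n
    rw [← (Fin.snocEquiv fun _ => ℕ).summable_iff] at hs
    rw [← (Fin.snocEquiv fun _ => ℕ).tsum_eq]
    refine hs.tsum_prod.trans ?_
    simp only [Function.comp_apply, snocEquiv_mk, chainTerm_snoc, Fin.snoc_last,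
      tsum_mul_left, ih]
    rw [innerSum_succ]
    refine tsum_eq_sum (s := range (n + 1)) fun c hc => ?_
    rw [mem_range, not_lt] at hc
    rw [slotWeight, qBinom_eq_zero_of_lt q (by omega), mul_zero, zero_mul]

theorem hasSum_KtermM {q : ℂ} (hq : ‖q‖ < 1) (y : ℕ → ℂ) (p : ℕ) :
    HasSum (fun n : ℕ => (-1) ^ n * q ^ (n * (n + 1) / 2) * y p ^ n * innerSum q y p n)
      (∑' c : Fin (p + 1) → ℕ, KtermM p 0 q (fun k => y k) c) := by
  have hs := summable_KtermM hq y p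
  rw [← (Fin.snocEquiv fun _ => ℕ).summable_iff] at hs
  rw [← (Fin.snocEquiv fun _ => ℕ).tsum_eq]
  have h := hs.hasSum.prod_fiberwise fun n => (hs.prod_factor n).hasSum
  refine h.congr_fun fun n => ?_
  simp only [Function.comp_apply, snocEquiv_mk, KtermM_eq, Fin.snoc_last, tsum_mul_left,
    tsum_chainTerm_snoc hq]

/-- for `m ≥ 2` (`m = p+2`), `0 < |q| < 1`, arbitrary `x_1,…,x_{m−1}` with
`x_{m−1} ≠ 0`,
`Σ_{j=0}^{m−2} q^j (x_{m−1−j} x_{m−j}⋯x_{m−2})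
   K_m^{(0)}(q⁻¹x_1,…,q⁻¹x_{m−2−j}, x_{m−1−j}, q x_{m−j},…,q x_{m−1})
 = (1/x_{m−1}) (1 − K_m^{(0)}(q⁻¹x_1,…,q⁻¹x_{m−1}))`;
the `j`-th coefficient is `q^j` times the product of the `x_i` with
`m−1−j ≤ i ≤ m−2` (empty for `j = 0`). -/
theorem stmt8 (m p : ℕ) (hm : m = p + 2) (q : ℂ) (hq0 : q ≠ 0) (hq1 : ‖q‖ < 1)
    (x : Fin (p + 1) → ℂ) (hx : x (Fin.last p) ≠ 0) :
    (∑ j ∈ Finset.range (p + 1),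
        q ^ j *
          (∏ k : Fin (p + 1), if p - j ≤ (k : ℕ) ∧ (k : ℕ) < p then x k else 1) *
          ∑' c : Fin (p + 1) → ℕ,
            KtermM p 0 q
              (fun k =>
                if (k : ℕ) + 1 ≤ p - j then q⁻¹ * x k
                else if (k : ℕ) + 1 = p + 1 - j then x k
                else q * x k) c) =
      (x (Fin.last p))⁻¹ *
        (1 - ∑' c : Fin (p + 1) → ℕ, KtermM p 0 q (fun k => q⁻¹ * x k) c) := by
  obtain ⟨X, rfl⟩ : ∃ X : ℕ → ℂ, x = fun k : Fin (p + 1) => X k :=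
    ⟨fun k => if h : k < p + 1 then x ⟨k, h⟩ else 0,
      funext fun k => by simp only [k.isLt, dite_true, Fin.eta]⟩
  simp only [Fin.val_last] at hx ⊢
  have hcoef : ∀ j, (∏ k : Fin (p + 1), if p - j ≤ (k : ℕ) ∧ (k : ℕ) < p then X k else 1) =
      ∏ k ∈ Ico (p - j) p, X k := by
    intro j
    rw [Fin.prod_univ_eq_prod_range (fun k => if p - j ≤ k ∧ k < p then X k else 1),
      ← prod_filter]
    exact prod_congr (by ext k; simp; omega) fun _ _ => rfl
  have hlhs := hasSum_sum (s := range (p + 1)) fun j _ =>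
    (hasSum_KtermM hq1 (shiftedArg q X p j) p).mul_left (q ^ j * ∏ k ∈ Ico (p - j) p, X k)
  have hrhs := ((hasSum_nat_add_iff' 1).2
    (hasSum_KtermM hq1 (fun k => q⁻¹ * X k) p)).mul_left (-(X p)⁻¹)
  simp only [hcoef]
  refine (hlhs.unique (hrhs.congr_fun fun n => ?_)).trans ?_
  · have hzero : shiftedArg q X p 0 p = X p := shiftedArg_sub q X (p := p) (Nat.zero_le p)
    have hpow : q ^ ((n + 1) * (n + 1 + 1) / 2) * (q⁻¹ * X p) ^ (n + 1) =
        q ^ (n * (n + 1) / 2) * X p ^ (n + 1) := by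
      rw [triangle_succ, mul_pow, inv_pow, pow_add]
      field_simp
    have hright : -(X p)⁻¹ * ((-1) ^ (n + 1) * q ^ ((n + 1) * (n + 1 + 1) / 2) *
        (q⁻¹ * X p) ^ (n + 1) * innerSum q (fun k => q⁻¹ * X k) p (n + 1)) =
        (-1) ^ n * q ^ (n * (n + 1) / 2) * X p ^ n *
          innerSum q (fun k => q⁻¹ * X k) p (n + 1) := by
      rw [mul_assoc ((-1) ^ (n + 1)), hpow]
      field_simp
      ring
    rw [hright, innerSum_succ_right hq0, sum_range_succ', hzero,
      innerSum_congr q (z := fun k => q⁻¹ * X k) fun k hk => shiftedArg_of_lt q X (by simpa),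
      mul_add ((-1) ^ n * _ * _), mul_sum, add_comm]
    congr 1
    · simp
    · refine sum_congr rfl fun j hj => ?_
      rw [mem_range] at hj
      rw [shiftedArg_of_gt q X (k := p) (by omega) (by omega)]
      ring
  · simp
    ring
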